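/- Let A ∈ ℝ^{n×n} be column-stochastic with a stationary distribution π ∈ ℝ^n (Aπ = π, π entrywise positive, entries summing to 1), and set β = π_{n-1}/(π_{n-1}+π_n). Let K̄ ∈ ℝ^{(n-1)×(n-1)} be any matrix, let K = B^T K̄ B ∈ ℝ^{n×n}, and fix c ∈ {1,…,n-1}. Let D_c ∈ ℝ^{n×n} be the diagonal matrix whose i-th diagonal entry is K_{i,c}, and let D̄_c ∈ ℝ^{(n-1)×(n-1)} be the diagonal matrix whose j-th diagonal entry is K̄_{j,c}. Then B A D_c A C_β − (B A C_β) D̄_c (B A C_β) = K̄_{n-1,c} · δout (δin)^T. -/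

import Mathlib

open Matrix

noncomputable section

/-- Projection ("merge") matrix `B ∈ ℝ^{(n-1)×n}` for `n = m+3` states, merging the two
last (aliased) states. -/
def Bmat (m : ℕ) : Matrix (Fin (m+2)) (Fin (m+3)) ℝ :=
  Matrix.of fun i j =>
    if ((i : ℕ) = (j : ℕ) ∧ (i : ℕ) ≤ m) ∨ ((i : ℕ) = m + 1 ∧ ((j : ℕ) = m + 1 ∨ (j : ℕ) = m + 2))
    then 1 else 0

/-- Lifting matrix `C_β ∈ ℝ^{n×(n-1)}`. -/
def Cmat (m : ℕ) (β : ℝ) : Matrix (Fin (m+3)) (Fin (m+2)) ℝ :=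
  Matrix.of fun i j =>
    if (i : ℕ) = (j : ℕ) ∧ (i : ℕ) ≤ m then 1
    else if (i : ℕ) = m + 1 ∧ (j : ℕ) = m + 1 then β
    else if (i : ℕ) = m + 2 ∧ (j : ℕ) = m + 1 then 1 - β
    else 0

/-- The first aliased state (state `n-1` in 1-based indexing). -/
def a1 (m : ℕ) : Fin (m+3) := ⟨m+1, by omega⟩
/-- The second aliased state (state `n` in 1-based indexing). -/
def a2 (m : ℕ) : Fin (m+3) := ⟨m+2, by omega⟩
/-- The merged pseudo-state (state `n-1` of the merged chain, 1-based). -/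
def aM (m : ℕ) : Fin (m+2) := ⟨m+1, by omega⟩

/-- The vector `b = e_{n-1} - e_n`. -/
def bvec (m : ℕ) : Fin (m+3) → ℝ := fun i =>
  if (i : ℕ) = m + 1 then 1 else if (i : ℕ) = m + 2 then -1 else 0

/-- The vector `c_β = (1-β) e_{n-1} - β e_n`. -/
def cvec (m : ℕ) (β : ℝ) : Fin (m+3) → ℝ := fun i =>
  if (i : ℕ) = m + 1 then 1 - β else if (i : ℕ) = m + 2 then -β else 0

/-- `P₁ = A_{n-1,n-1} + A_{n,n-1}`. -/
def P1 (m : ℕ) (A : Matrix (Fin (m+3)) (Fin (m+3)) ℝ) : ℝ := A (a1 m) (a1 m) + A (a2 m) (a1 m)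
/-- `P₂ = A_{n-1,n} + A_{n,n}`. -/
def P2 (m : ℕ) (A : Matrix (Fin (m+3)) (Fin (m+3)) ℝ) : ℝ := A (a1 m) (a2 m) + A (a2 m) (a2 m)

/-- The vector `δout ∈ ℝ^{n-1}`. -/
def dOut (m : ℕ) (A : Matrix (Fin (m+3)) (Fin (m+3)) ℝ) : Fin (m+2) → ℝ := fun i =>
  if (i : ℕ) ≤ m then A i.castSucc (a1 m) - A i.castSucc (a2 m) else P1 m A - P2 m A

/-- The vector `δin ∈ ℝ^{n-1}`. -/
def dIn (m : ℕ) (A : Matrix (Fin (m+3)) (Fin (m+3)) ℝ) (β : ℝ) : Fin (m+2) → ℝ := fun j =>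
  if (j : ℕ) ≤ m then A (a1 m) j.castSucc - β * (A (a1 m) j.castSucc + A (a2 m) j.castSucc)
  else β * (A (a1 m) (a1 m) - β * P1 m A) + (1 - β) * (A (a1 m) (a2 m) - β * P2 m A)

/-- The scalar `κ`. -/
def kap (m : ℕ) (A : Matrix (Fin (m+3)) (Fin (m+3)) ℝ) (β : ℝ) : ℝ :=
  (A (a1 m) (a1 m) - β * P1 m A) - (A (a1 m) (a2 m) - β * P2 m A)

/-- A square matrix is column-stochastic: nonnegative entries, every column sums to `1`. -/
def ColStoch {k : ℕ} (M : Matrix (Fin k) (Fin k) ℝ) : Prop :=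
  (∀ i j, 0 ≤ M i j) ∧ ∀ j, ∑ i, M i j = 1

lemma B_castSucc (m : ℕ) (i k : Fin (m+2)) :
    Bmat m i k.castSucc = if k = i then 1 else 0 := by
  have := i.2; have := k.2
  simp only [Bmat, Matrix.of_apply, Fin.val_castSucc, Fin.ext_iff]
  congr 1; apply propext; omega

lemma B_last (m : ℕ) (i : Fin (m+2)) :
    Bmat m i (Fin.last (m+2)) = if aM m = i then 1 else 0 := by
  have := i.2
  simp only [Bmat, Matrix.of_apply, Fin.val_last, Fin.ext_iff, aM, true_and, or_true, and_true]
  refine if_congr ?_ rfl rfl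
  omega

lemma C_castSucc (m : ℕ) (β : ℝ) (k j : Fin (m+2)) :
    Cmat m β k.castSucc j = if k = j then (if aM m = j then β else 1) else 0 := by
  have := j.2; have := k.2
  simp only [Cmat, Matrix.of_apply, Fin.val_castSucc, Fin.ext_iff, aM]
  split_ifs <;> first | rfl | omega

lemma C_last (m : ℕ) (β : ℝ) (j : Fin (m+2)) :
    Cmat m β (Fin.last (m+2)) j = if aM m = j then 1 - β else 0 := by
  have := j.2
  simp only [Cmat, Matrix.of_apply, Fin.val_last, Fin.ext_iff, aM, true_and, or_true, and_true]
  split_ifs <;> first | rfl | omega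

lemma a1_eq (m : ℕ) : a1 m = (aM m).castSucc := rfl
lemma a2_eq (m : ℕ) : a2 m = Fin.last (m+2) := rfl

lemma b_castSucc (m : ℕ) (k : Fin (m+2)) :
    bvec m k.castSucc = if aM m = k then 1 else 0 := by
  have := k.2
  simp only [bvec, Fin.val_castSucc, Fin.ext_iff, aM]
  split_ifs <;> first | rfl | omega
lemma b_last (m : ℕ) : bvec m (Fin.last (m+2)) = -1 := by simp [bvec]
lemma c_castSucc (m : ℕ) (β : ℝ) (k : Fin (m+2)) :
    cvec m β k.castSucc = if aM m = k then 1 - β else 0 := by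
  have := k.2
  simp only [cvec, Fin.val_castSucc, Fin.ext_iff, aM]
  split_ifs <;> first | rfl | omega
lemma c_last (m : ℕ) (β : ℝ) : cvec m β (Fin.last (m+2)) = -β := by simp [cvec]

lemma le_iff_ne_aM (m : ℕ) (i : Fin (m+2)) : (i : ℕ) ≤ m ↔ ¬ aM m = i := by
  have := i.2
  simp only [Fin.ext_iff, aM]; omega

lemma dOut_eq (m : ℕ) (A : Matrix (Fin (m+3)) (Fin (m+3)) ℝ) :
    (Bmat m * A) *ᵥ bvec m = dOut m A := by
  funext i
  simp only [dOut, le_iff_ne_aM, P1, P2, a1_eq, a2_eq, Matrix.mulVec, dotProduct,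
    Matrix.mul_apply, Fin.sum_univ_castSucc (n := m+2), B_castSucc, B_last, b_castSucc, b_last]
  by_cases h : aM m = i
  · subst h; simp; ring
  · simp [h]; ring

lemma dIn_eq (m : ℕ) (A : Matrix (Fin (m+3)) (Fin (m+3)) ℝ) (β : ℝ) :
    cvec m β ᵥ* (A * Cmat m β) = dIn m A β := by
  funext j
  simp only [dIn, le_iff_ne_aM, P1, P2, a1_eq, a2_eq, Matrix.vecMul, dotProduct,
    Matrix.mul_apply, Fin.sum_univ_castSucc (n := m+2), C_castSucc, C_last, c_castSucc, c_last]
  by_cases h : aM m = j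
  · subst h; simp; ring
  · simp [h]; ring

lemma K_castSucc (m : ℕ) (Kbar : Matrix (Fin (m+2)) (Fin (m+2)) ℝ) (i c : Fin (m+2)) :
    ((Bmat m)ᵀ * Kbar * Bmat m) i.castSucc c.castSucc = Kbar i c := by
  simp [Matrix.mul_apply, B_castSucc]
lemma K_last (m : ℕ) (Kbar : Matrix (Fin (m+2)) (Fin (m+2)) ℝ) (c : Fin (m+2)) :
    ((Bmat m)ᵀ * Kbar * Bmat m) (Fin.last (m+2)) c.castSucc = Kbar (aM m) c := by
  simp [Matrix.mul_apply, B_castSucc, B_last]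

lemma core (m : ℕ) (β : ℝ) (Kbar : Matrix (Fin (m+2)) (Fin (m+2)) ℝ) (c : Fin (m+2)) :
    Matrix.diagonal (fun i => ((Bmat m)ᵀ * Kbar * Bmat m) i c.castSucc)
      - Cmat m β * Matrix.diagonal (fun j => Kbar j c) * Bmat m
      = Kbar (aM m) c • vecMulVec (bvec m) (cvec m β) := by
  ext i j
  rw [Matrix.sub_apply, Matrix.mul_apply, Matrix.smul_apply, vecMulVec_apply]
  simp only [Matrix.mul_diagonal, Matrix.diagonal_apply]
  induction i using Fin.lastCases with
  | last =>
    induction j using Fin.lastCases with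
    | last => simp [K_last, C_last, B_last, b_last, c_last]; ring
    | cast j =>
      by_cases h : aM m = j
      · subst h
        simp [C_last, B_castSucc, b_last, c_castSucc, (Fin.castSucc_lt_last _).ne']; ring
      · simp [C_last, B_castSucc, b_last, c_castSucc, h, (Fin.castSucc_lt_last _).ne']
  | cast i =>
    induction j using Fin.lastCases with
    | last =>
      by_cases h : aM m = i
      · subst h
        simp [C_castSucc, B_last, b_castSucc, c_last, (Fin.castSucc_lt_last _).ne]; ring
      · simp [C_castSucc, B_last, b_castSucc, c_last, h, Ne.symm h, (Fin.castSucc_lt_last _).ne]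
        try (intro h2; exact absurd h2.symm h)
    | cast j =>
      rw [K_castSucc]
      by_cases h : aM m = i
      · subst h
        by_cases h2 : aM m = j
        · subst h2
          simp [C_castSucc, B_castSucc, b_castSucc, c_castSucc]; ring
        · simp [C_castSucc, B_castSucc, b_castSucc, c_castSucc, h2, Ne.symm h2]
      · by_cases h2 : i = j
        · subst h2
          simp [C_castSucc, B_castSucc, b_castSucc, c_castSucc, h]
        · simp [C_castSucc, B_castSucc, b_castSucc, c_castSucc, h, h2, Ne.symm h2]

theorem stmt4 (m : ℕ) (A : Matrix (Fin (m+3)) (Fin (m+3)) ℝ) (hA : ColStoch A)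
    (π : Fin (m+3) → ℝ) (hstat : A.mulVec π = π) (hpos : ∀ i, 0 < π i)
    (hsum : ∑ i, π i = 1)
    (β : ℝ) (hβ : β = π (a1 m) / (π (a1 m) + π (a2 m)))
    (Kbar : Matrix (Fin (m+2)) (Fin (m+2)) ℝ) (c : Fin (m+2))
    (K : Matrix (Fin (m+3)) (Fin (m+3)) ℝ) (hK : K = (Bmat m)ᵀ * Kbar * Bmat m)
    (D : Matrix (Fin (m+3)) (Fin (m+3)) ℝ) (hD : D = Matrix.diagonal (fun i => K i c.castSucc))
    (Dbar : Matrix (Fin (m+2)) (Fin (m+2)) ℝ) (hDbar : Dbar = Matrix.diagonal (fun j => Kbar j c)) :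
    Bmat m * A * D * A * Cmat m β
      - (Bmat m * A * Cmat m β) * Dbar * (Bmat m * A * Cmat m β)
      = Kbar (aM m) c • vecMulVec (dOut m A) (dIn m A β) := by
  subst hK hD hDbar
  have key : Bmat m * A * Matrix.diagonal (fun i => ((Bmat m)ᵀ * Kbar * Bmat m) i c.castSucc)
        * A * Cmat m β
      - (Bmat m * A * Cmat m β) * Matrix.diagonal (fun j => Kbar j c) * (Bmat m * A * Cmat m β)
      = (Bmat m * A) * (Matrix.diagonal (fun i => ((Bmat m)ᵀ * Kbar * Bmat m) i c.castSucc)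
      - Cmat m β * Matrix.diagonal (fun j => Kbar j c) * Bmat m) * (A * Cmat m β) := by
    simp only [Matrix.mul_sub, Matrix.sub_mul, Matrix.mul_assoc]
  rw [key, core, Matrix.mul_smul, Matrix.smul_mul, Matrix.mul_vecMulVec, Matrix.vecMulVec_mul,
    dOut_eq, dIn_eq]
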